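/- Let α > 0, let ν be a Borel probability measure on ℝ₊, let T, L > 1 and r > 0, and let ε, l, p, κ, γ, M, N be as in the good-path properties. Suppose a processor-sharing path satisfies the level-(ε, l, κ, γ, M) properties (for r, T, L). Then sup_{0≤m≤⌊rT⌋} sup_{t∈[0,L]} ⟨1_{[0,κ]}, μ̄^{r,m}(t)⟩ ≤ ε/2, i.e., μ̄^{r,m}(t)([0,κ]) ≤ ε/2 for every integer 0 ≤ m ≤ ⌊rT⌋ and every t ∈ [0,L]. -/

import Mathlib

open MeasureTheory Filter Set
noncomputable section
namespace PSQ

/-- ⟨g, ζ⟩ = ∫ g dζ -/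
def pair (g : ℝ → ℝ) (ζ : Measure ℝ) : ℝ := ∫ x, g x ∂ζ

/-- total mass ⟨1, ζ⟩ of a finite measure, as a real number -/
def mass (ζ : Measure ℝ) : ℝ := (ζ Set.univ).toReal

/-- truncated Dirac measure δ⁺ₓ -/
def dplus (x : ℝ) : Measure ℝ := if 0 < x then Measure.dirac x else 0

/-- positive part x⁺ -/
def pos (x : ℝ) : ℝ := max x 0

/-- the arrival counting process E(t) = sup{i : U i ≤ t} -/
def Ecount (U : ℕ → ℝ) (t : ℝ) : ℕ := sSup {i : ℕ | U i ≤ t}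

/-- the standing hypotheses on the data of a pathwise processor sharing queue:
nondecreasing arrival times with `U 0 = 0`, `U 1 > 0`, `U i → ∞`, and strictly positive
service times and initial service times. -/
def QueueHyps (U v : ℕ → ℝ) (Z0 : ℕ) (vt : ℕ → ℝ) : Prop :=
  U 0 = 0 ∧ Monotone U ∧ 0 < U 1 ∧ Tendsto U atTop atTop ∧
    (∀ i, 1 ≤ i → 0 < v i) ∧ (∀ j, 1 ≤ j → 0 < vt j)

/-- the defining equations of the state descriptor μ and the cumulative service per
job S:  `S t = ∫_0^t φ(⟨1, μ(s)⟩) ds` (recall `(0:ℝ)⁻¹ = 0` in Lean, matching φ(0)=0)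
and `μ(t) = Σ_j δ⁺_{(ṽ_j - S(t))⁺} + Σ_{i ≤ E(t)} δ⁺_{(v_i - S(t) + S(U_i))⁺}`. -/
def StateEqns (U v : ℕ → ℝ) (Z0 : ℕ) (vt : ℕ → ℝ)
    (μ : ℝ → Measure ℝ) (S : ℝ → ℝ) : Prop :=
  ∀ t, 0 ≤ t →
    (S t = ∫ s in (0:ℝ)..t, (mass (μ s))⁻¹) ∧
    μ t = (∑ j ∈ Finset.range Z0, dplus (pos (vt (j+1) - S t)))
        + ∑ i ∈ Finset.range (Ecount U t), dplus (pos (v (i+1) - S t + S (U (i+1))))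

/-- fluid scaled state descriptor μ̄^r(t) = r⁻¹ μ(rt) -/
def fmu (μ : ℝ → Measure ℝ) (r t : ℝ) : Measure ℝ := ENNReal.ofReal (1/r) • μ (r*t)

/-- fluid scaled arrival process Ē^r(t) = r⁻¹ E(rt) -/
def fE (U : ℕ → ℝ) (r t : ℝ) : ℝ := (Ecount U (r*t) : ℝ) / r

/-- fluid scaled cumulative service S̄^r_{t,t'} = S(r t') - S(r t) -/
def fS (S : ℝ → ℝ) (r t t' : ℝ) : ℝ := S (r*t') - S (r*t)

end PSQ
end

namespace PSQ

/-- The constraints tying together the constants of the good-path properties: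
`ε ∈ (0,1)`, `l, p, κ, γ > 0`, `M > 1`, `l < ε/(32α)`, `κ < l/(2M)`,
`γ < (κε/4) ∧ (l/4)`. -/
def GoodConsts (α ε l p κ γ M : ℝ) : Prop :=
  ε ∈ Set.Ioo (0:ℝ) 1 ∧ 0 < l ∧ 0 < p ∧ 0 < κ ∧ 0 < γ ∧ 1 < M ∧
    l < ε/(32*α) ∧ κ < l/(2*M) ∧ γ < min (κ*ε/4) (l/4)

/-- A processor sharing path satisfies the level-(ε, l, κ, γ, M) good-path properties
(for r, T, L), with `N = ⌈64M²/(κε²)⌉ + 1`. -/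
def GoodPath (U v : ℕ → ℝ) (μ : ℝ → Measure ℝ) (ν : Measure ℝ)
    (T L r ε l p κ γ M : ℝ) : Prop :=
  ∀ m : ℕ, m ≤ ⌊r * T⌋₊ →
    (∀ t ∈ Set.Icc (0:ℝ) L, fE U r ((m:ℝ) + t + l) - fE U r ((m:ℝ) + t) ≤ ε/16) ∧
    (∀ t ∈ Set.Icc (0:ℝ) L,
      max (max (mass (fmu μ r ((m:ℝ)+t))) (pair id (fmu μ r ((m:ℝ)+t))))
        (pair (fun x => x ^ ((1:ℝ)+p)) (fmu μ r ((m:ℝ)+t))) ≤ M) ∧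
    (∀ x : ℝ, 0 ≤ x → ((fmu μ r 0) (Set.Icc x (x+κ))).toReal ≤ ε/4) ∧
    (∀ t ∈ Set.Icc (0:ℝ) L,
      |pair id (fmu μ r ((m:ℝ)+t)) - pair id (fmu μ r (m:ℝ))| ≤ γ/4) ∧
    (∀ t ∈ Set.Icc (0:ℝ) L, ∀ k : ℕ, k ≤ ⌈64*M^2/(κ*ε^2)⌉₊ + 1 →
      (1/r) * (∑ i ∈ Finset.Ioc (Ecount U (r*((m:ℝ)+t))) (Ecount U (r*((m:ℝ)+t+l))),
          if (k:ℝ)*κ ≤ v i ∧ v i < ((k:ℝ)+1)*κ then (1:ℝ) else 0)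
        ≤ (ε/8) * (ν (Set.Ico (((k:ℝ)-1/2)*κ) (((k:ℝ)+3/2)*κ))).toReal)

end PSQ

namespace PSQ

open MeasureTheory Filter

section Pairing

lemma integrable_dplus (g : ℝ → ℝ) (x : ℝ) : Integrable g (dplus x) := by
  unfold dplus
  split_ifs
  · exact integrable_dirac (by simp)
  · exact integrable_zero_measure

lemma integral_dplus_pos (g : ℝ → ℝ) (x : ℝ) :
    ∫ y, g y ∂(dplus (pos x)) = if 0 < x then g x else 0 := by
  unfold dplus pos
  by_cases h : 0 < x
  · simp [h, max_eq_left h.le]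
  · simp [h]

variable {U v : ℕ → ℝ} {Z0 : ℕ} {vt : ℕ → ℝ} {μ : ℝ → Measure ℝ} {S : ℝ → ℝ}

lemma StateEqns.pair_eq (h : StateEqns U v Z0 vt μ S) (g : ℝ → ℝ) {t : ℝ} (ht : 0 ≤ t) :
    pair g (μ t) =
      (∑ j ∈ Finset.range Z0, if 0 < vt (j + 1) - S t then g (vt (j + 1) - S t) else 0) +
      ∑ i ∈ Finset.range (Ecount U t),
        if 0 < v (i + 1) - S t + S (U (i + 1)) then g (v (i + 1) - S t + S (U (i + 1))) else 0 := by
  have hi : ∀ x, Integrable g (dplus x) := integrable_dplus g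
  rw [pair, (h t ht).2, integral_add_measure (integrable_finsetSum_measure.2 fun _ _ => hi _)
    (integrable_finsetSum_measure.2 fun _ _ => hi _),
    integral_finsetSum_measure fun _ _ => hi _, integral_finsetSum_measure fun _ _ => hi _]
  simp only [integral_dplus_pos]

lemma pair_fmu (g : ℝ → ℝ) {r : ℝ} (hr : 0 < r) (t : ℝ) :
    pair g (fmu μ r t) = 1 / r * pair g (μ (r * t)) := by
  rw [pair, fmu, integral_smul_measure, ENNReal.toReal_ofReal (by positivity), smul_eq_mul, pair]

lemma mass_eq_pair (ζ : Measure ℝ) : mass ζ = pair (fun _ => 1) ζ := by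
  simp [mass, pair, Measure.real]

lemma toReal_apply_eq_pair (ζ : Measure ℝ) {A : Set ℝ} (hA : MeasurableSet A) :
    (ζ A).toReal = pair (A.indicator 1) ζ := by
  rw [pair, integral_indicator_one hA, Measure.real]

/-- The total mass is the number of jobs present. -/
lemma StateEqns.mass_eq (h : StateEqns U v Z0 vt μ S) {t : ℝ} (ht : 0 ≤ t) :
    mass (μ t) = (({j ∈ Finset.range Z0 | 0 < vt (j + 1) - S t}.card +
      {i ∈ Finset.range (Ecount U t) | 0 < v (i + 1) - S t + S (U (i + 1))}.card : ℕ) : ℝ) := by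
  rw [mass_eq_pair, h.pair_eq _ ht, Finset.sum_boole, Finset.sum_boole, Nat.cast_add]

end Pairing

section Arrivals

variable {U : ℕ → ℝ}

lemma le_Ecount_iff (hU : Monotone U) (hU' : Tendsto U atTop atTop) {i : ℕ} {t : ℝ}
    (h0 : U 0 ≤ t) : i ≤ Ecount U t ↔ U i ≤ t := by
  have hb : BddAbove {i : ℕ | U i ≤ t} := by
    obtain ⟨n, hn⟩ := (hU'.eventually_gt_atTop t).exists
    refine ⟨n, fun i hi => ?_⟩
    by_contra! hlt
    exact absurd (hU hlt.le) (not_le.2 (lt_of_le_of_lt hi hn))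
  constructor
  · intro h
    exact (hU h).trans (Nat.sSup_mem ⟨0, h0⟩ hb)
  · intro h
    exact le_csSup hb h

end Arrivals

section Service

variable {U v : ℕ → ℝ} {Z0 : ℕ} {vt : ℕ → ℝ} {μ : ℝ → Measure ℝ} {S : ℝ → ℝ}

lemma inv_mass_nonneg (ζ : Measure ℝ) : 0 ≤ (mass ζ)⁻¹ :=
  inv_nonneg.2 ENNReal.toReal_nonneg

lemma StateEqns.aemeasurable (h : StateEqns U v Z0 vt μ S) :
    AEMeasurable S (volume.restrict (Set.Ici 0)) := by
  set f : ℝ → ℝ := fun s => (mass (μ s))⁻¹ with hf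
  set A : Set ℝ := {t | 0 ≤ t ∧ IntervalIntegrable f volume 0 t} with hA
  have hsub : ∀ ⦃t⦄, t ∈ A → ∀ ⦃s⦄, 0 ≤ s → s ≤ t → s ∈ A := fun t ht s hs hst =>
    ⟨hs, ht.2.mono_set (by
      rw [Set.uIcc_of_le hs, Set.uIcc_of_le ht.1]
      exact Set.Icc_subset_Icc_right hst)⟩
  have hAm : MeasurableSet A := by
    refine Set.OrdConnected.measurableSet ⟨fun x hx y hy z hz => ?_⟩
    exact hsub hy (hx.1.trans hz.1) hz.2
  have hmono : MonotoneOn S A := by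
    intro x hx y hy hxy
    rw [(h x hx.1).1, (h y hy.1).1]
    exact intervalIntegral.integral_mono_interval le_rfl hx.1 hxy
      (Eventually.of_forall fun s => inv_mass_nonneg _) hy.2
  have hunion : Set.Ici (0 : ℝ) = A ∪ (Set.Ici 0 \ A) :=
    (Set.union_sdiff_cancel fun t ht => ht.1).symm
  rw [hunion, aemeasurable_union_iff]
  refine ⟨aemeasurable_restrict_of_monotoneOn hAm hmono, ?_⟩
  refine (aemeasurable_const (b := (0 : ℝ))).congr ?_
  filter_upwards [ae_restrict_mem (measurableSet_Ici.diff hAm)] with t ht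
  rw [(h t ht.1).1, intervalIntegral.integral_undef fun hi => ht.2 ⟨ht.1, hi⟩]

lemma StateEqns.intervalIntegrable (h : StateEqns U v Z0 vt μ S) (hU0 : U 0 = 0)
    (hU : Monotone U) (hU' : Tendsto U atTop atTop) {t : ℝ} (ht : 0 ≤ t) :
    IntervalIntegrable (fun s => (mass (μ s))⁻¹) volume 0 t := by
  rw [intervalIntegrable_iff_integrableOn_Ioc_of_le ht]
  have hS : AEMeasurable S (volume.restrict (Set.Ioc 0 t)) :=
    h.aemeasurable.mono_set fun s hs => hs.1.le
  have hle : ∀ c : ℝ, AEMeasurable (fun s => if 0 < c - S s then (1 : ℝ) else 0)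
      (volume.restrict (Set.Ioc 0 t)) := fun c =>
    (Measurable.ite (measurableSet_lt measurable_const (measurable_const.sub measurable_id))
      measurable_const measurable_const : Measurable fun x : ℝ => if 0 < c - x then (1 : ℝ) else 0)
      |>.comp_aemeasurable hS
  have hind : ∀ c : ℝ, AEMeasurable (fun s => if c ≤ s then (1 : ℝ) else 0)
      (volume.restrict (Set.Ioc 0 t)) := fun c =>
    (Measurable.ite measurableSet_Ici measurable_const measurable_const).aemeasurable
  have hm : AEMeasurable (fun s => mass (μ s)) (volume.restrict (Set.Ioc 0 t)) := by
    refine AEMeasurable.congr (f := fun s =>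
      (∑ j ∈ Finset.range Z0, if 0 < vt (j + 1) - S s then (1 : ℝ) else 0) +
      ∑ i ∈ Finset.range (Ecount U t), (if U (i + 1) ≤ s then (1 : ℝ) else 0) *
        if 0 < v (i + 1) + S (U (i + 1)) - S s then (1 : ℝ) else 0) ?_ ?_
    · exact (Finset.aemeasurable_fun_sum _ fun j _ => hle _).add
        (Finset.aemeasurable_fun_sum _ fun i _ => (hind _).mul (hle _))
    · filter_upwards [ae_restrict_mem measurableSet_Ioc] with s hs
      rw [mass_eq_pair, h.pair_eq _ hs.1.le]
      congr 1
      have hEs : ∀ i, i ∈ Finset.range (Ecount U s) ↔ U (i + 1) ≤ s := fun i => by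
        rw [Finset.mem_range, ← Nat.succ_le_iff, le_Ecount_iff hU hU' (hU0.le.trans hs.1.le)]
      have hEt : Finset.range (Ecount U s) ⊆ Finset.range (Ecount U t) := fun i hi => by
        rw [Finset.mem_range, ← Nat.succ_le_iff, le_Ecount_iff hU hU' (hU0.le.trans ht)]
        exact ((hEs i).1 hi).trans hs.2
      rw [← Finset.sum_subset hEt fun i _ hi => by rw [if_neg (mt (hEs i).2 hi), zero_mul]]
      refine Finset.sum_congr rfl fun i hi => ?_
      rw [if_pos ((hEs i).1 hi), one_mul, sub_add_eq_add_sub]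
  refine Integrable.of_bound hm.inv.aestronglyMeasurable 1 ?_
  filter_upwards [ae_restrict_mem measurableSet_Ioc] with s hs
  rw [h.mass_eq hs.1.le, norm_inv, Real.norm_natCast]
  exact Nat.cast_inv_le_one _

lemma StateEqns.sub_eq (h : StateEqns U v Z0 vt μ S) (hU0 : U 0 = 0)
    (hU : Monotone U) (hU' : Tendsto U atTop atTop) {s t : ℝ} (hs : 0 ≤ s) (ht : 0 ≤ t) :
    S t - S s = ∫ u in s..t, (mass (μ u))⁻¹ := by
  rw [(h t ht).1, (h s hs).1]
  exact intervalIntegral.integral_interval_sub_left (h.intervalIntegrable hU0 hU hU' ht)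
    (h.intervalIntegrable hU0 hU hU' hs)

lemma StateEqns.monotoneOn (h : StateEqns U v Z0 vt μ S) (hU0 : U 0 = 0)
    (hU : Monotone U) (hU' : Tendsto U atTop atTop) : MonotoneOn S (Set.Ici 0) := by
  intro s hs t ht hst
  rw [← sub_nonneg, h.sub_eq hU0 hU hU' hs ht]
  exact intervalIntegral.integral_nonneg hst fun u _ => inv_mass_nonneg _

/-- While the queue is nonempty and holds at most `K` jobs, each job is served at rate at
least `1 / K`. -/
lemma StateEqns.sub_le_mul (h : StateEqns U v Z0 vt μ S) (hU0 : U 0 = 0)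
    (hU : Monotone U) (hU' : Tendsto U atTop atTop) {s t K : ℝ} (hs : 0 ≤ s) (hst : s ≤ t)
    (hK : 0 < K) (hpos : ∀ u ∈ Set.Icc s t, 0 < mass (μ u))
    (hle : ∀ u ∈ Set.Icc s t, mass (μ u) ≤ K) :
    t - s ≤ K * (S t - S s) := by
  have hint : IntervalIntegrable (fun u => (mass (μ u))⁻¹) volume s t :=
    (h.intervalIntegrable hU0 hU hU' hs).symm.trans
      (h.intervalIntegrable hU0 hU hU' (hs.trans hst))
  have key : (t - s) * K⁻¹ ≤ S t - S s := by
    rw [h.sub_eq hU0 hU hU' hs (hs.trans hst)]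
    calc (t - s) * K⁻¹ = ∫ _ in s..t, K⁻¹ := by simp
      _ ≤ _ := intervalIntegral.integral_mono_on hst intervalIntegrable_const hint
        fun u hu => inv_anti₀ (hpos u hu) (hle u hu)
  rwa [← div_eq_mul_inv, div_le_iff₀' hK] at key

/-- The queue is nonempty from the arrival of a job until its departure. -/
lemma StateEqns.mass_pos (h : StateEqns U v Z0 vt μ S) (hU0 : U 0 = 0)
    (hU : Monotone U) (hU' : Tendsto U atTop atTop) {i : ℕ} {s u : ℝ} (hiu : U (i + 1) ≤ u)
    (hus : u ≤ s) (hi : 0 < v (i + 1) - S s + S (U (i + 1))) : 0 < mass (μ u) := by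
  have hu : 0 ≤ u := (hU0 ▸ hU (Nat.zero_le (i + 1)) : 0 ≤ U (i + 1)).trans hiu
  have hS := h.monotoneOn hU0 hU hU' hu (hu.trans hus) hus
  rw [h.mass_eq hu, Nat.cast_pos]
  refine Nat.add_pos_right _ (Finset.card_pos.2 ⟨i, ?_⟩)
  rw [Finset.mem_filter, Finset.mem_range, ← Nat.succ_le_iff,
    le_Ecount_iff hU hU' (hU0.le.trans hu)]
  exact ⟨hiu, by linarith⟩

end Service

/-- Consecutive overlapping intervals along a monotone sequence cover each point at most twice. -/
lemma sum_measure_Ico_add_two_le (ν : Measure ℝ) [IsProbabilityMeasure ν] {a : ℕ → ℝ}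
    (ha : Monotone a) (n : ℕ) :
    ∑ k ∈ Finset.range n, (ν (Set.Ico (a k) (a (k + 2)))).toReal ≤ 2 := by
  set F : ℕ → ℝ := fun k => ν.real (Set.Iio (a k)) with hF
  have h : ∀ k, (ν (Set.Ico (a k) (a (k + 2)))).toReal = F (k + 2) - F k := fun k => by
    have hd : Set.Ico (a k) (a (k + 2)) = Set.Iio (a (k + 2)) \ Set.Iio (a k) := by
      ext x
      simp
    rw [hd]
    exact measureReal_sdiff (Set.Iio_subset_Iio (ha (by lia))) measurableSet_Iio
  have hsum : ∑ k ∈ Finset.range n, (ν (Set.Ico (a k) (a (k + 2)))).toReal =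
      F (n + 1) + F n - F 1 - F 0 := by
    induction n with
    | zero => simp
    | succ n ih => rw [Finset.sum_range_succ, ih, h]; ring
  have h0 : ∀ k, 0 ≤ F k := fun k => measureReal_nonneg
  have h1 : ∀ k, F k ≤ 1 := fun k => measureReal_le_one
  rw [hsum]
  linarith [h0 0, h0 1, h1 n, h1 (n + 1)]

section GoodPaths

variable {U v : ℕ → ℝ} {Z0 : ℕ} {vt : ℕ → ℝ} {μ : ℝ → Measure ℝ} {S : ℝ → ℝ} {ν : Measure ℝ}
  {T L r ε l p κ γ M : ℝ}

/-- Every time before a time covered by the good-path properties is covered as well. -/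
lemma exists_nat_add_mem_Icc {n m : ℕ} {t u : ℝ} (hL : 1 < L) (hm : m ≤ n)
    (ht : t ∈ Set.Icc 0 L) (hu : 0 ≤ u) (hut : u ≤ m + t) :
    ∃ m' : ℕ, m' ≤ n ∧ ∃ t' ∈ Set.Icc 0 L, u = m' + t' := by
  rcases le_total (m : ℝ) u with h | h
  · exact ⟨m, hm, u - m, ⟨by linarith, by linarith [ht.2]⟩, by ring⟩
  · refine ⟨⌊u⌋₊, (Nat.floor_le_of_le h).trans hm, u - ⌊u⌋₊, ⟨?_, ?_⟩, by ring⟩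
    · linarith [Nat.floor_le hu]
    · linarith [Nat.lt_floor_add_one u]

lemma GoodPath.mass_le (hgood : GoodPath U v μ ν T L r ε l p κ γ M) (hL : 1 < L) (hr : 0 < r)
    {m : ℕ} {t u : ℝ} (hm : m ≤ ⌊r * T⌋₊) (ht : t ∈ Set.Icc 0 L) (hu : 0 ≤ u)
    (hut : u ≤ r * (m + t)) : mass (μ u) ≤ r * M := by
  obtain ⟨m', hm', t', ht', he⟩ := exists_nat_add_mem_Icc hL hm ht (div_nonneg hu hr.le)
    ((div_le_iff₀' hr).2 hut)
  have h := ((le_max_left _ _).trans (le_max_left _ _)).trans ((hgood m' hm').2.1 t' ht')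
  rw [mass_eq_pair, pair_fmu _ hr, ← he, mul_div_cancel₀ _ hr.ne', ← mass_eq_pair] at h
  rwa [one_div, inv_mul_le_iff₀ hr] at h

lemma GoodPath.pair_id_le (hgood : GoodPath U v μ ν T L r ε l p κ γ M) (hL : 1 < L) (hr : 0 < r)
    {m : ℕ} {t u : ℝ} (hm : m ≤ ⌊r * T⌋₊) (ht : t ∈ Set.Icc 0 L) (hu : 0 ≤ u)
    (hut : u ≤ r * (m + t)) : pair id (μ u) ≤ r * M := by
  obtain ⟨m', hm', t', ht', he⟩ := exists_nat_add_mem_Icc hL hm ht (div_nonneg hu hr.le)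
    ((div_le_iff₀' hr).2 hut)
  have h := ((le_max_right _ _).trans (le_max_left _ _)).trans ((hgood m' hm').2.1 t' ht')
  rw [pair_fmu _ hr, ← he, mul_div_cancel₀ _ hr.ne'] at h
  rwa [one_div, inv_mul_le_iff₀ hr] at h

/-- The jobs among the initial ones whose residual service time lies in `(0, κ]`. -/
noncomputable def nearInitial (Z0 : ℕ) (vt : ℕ → ℝ) (S : ℝ → ℝ) (κ t : ℝ) : Finset ℕ :=
  {j ∈ Finset.range Z0 | 0 < vt (j + 1) - S t ∧ vt (j + 1) - S t ≤ κ}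

/-- The jobs among the arrived ones whose residual service time lies in `(0, κ]`. -/
noncomputable def nearArrived (U v : ℕ → ℝ) (S : ℝ → ℝ) (κ t : ℝ) : Finset ℕ :=
  {i ∈ Finset.range (Ecount U t) | 0 < v (i + 1) - S t + S (U (i + 1)) ∧
    v (i + 1) - S t + S (U (i + 1)) ≤ κ}

lemma StateEqns.toReal_Icc_eq (h : StateEqns U v Z0 vt μ S) {t : ℝ} (ht : 0 ≤ t) :
    (μ t (Set.Icc 0 κ)).toReal =
      (nearInitial Z0 vt S κ t).card + (nearArrived U v S κ t).card := by
  have hind : ∀ x : ℝ, (if 0 < x then (Set.Icc 0 κ).indicator (1 : ℝ → ℝ) x else 0) =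
      if 0 < x ∧ x ≤ κ then 1 else 0 := fun x => by
    by_cases hx : 0 < x
    · simp [Set.indicator_apply, hx, hx.le]
    · simp [hx]
  rw [toReal_apply_eq_pair _ measurableSet_Icc, h.pair_eq _ ht]
  simp only [hind, Finset.sum_boole, nearInitial, nearArrived]

lemma card_nearInitial_le (hgood : GoodPath U v μ ν T L r ε l p κ γ M)
    (h : StateEqns U v Z0 vt μ S) (hU0 : U 0 = 0) (hU : Monotone U)
    (hU' : Tendsto U atTop atTop) (hU1 : 0 < U 1) (hvt : ∀ j, 1 ≤ j → 0 < vt j) (hr : 0 < r)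
    {t : ℝ} (ht : 0 ≤ t) : (nearInitial Z0 vt S κ t).card ≤ r * (ε / 4) := by
  have hS0 : S 0 = 0 := by rw [(h 0 le_rfl).1, intervalIntegral.integral_same]
  have hSt : 0 ≤ S t := hS0 ▸ h.monotoneOn hU0 hU hU' Set.self_mem_Ici ht ht
  have hE : Ecount U 0 = 0 := by
    by_contra hne
    exact absurd ((le_Ecount_iff hU hU' hU0.le).1 (Nat.one_le_iff_ne_zero.2 hne)) hU1.not_ge
  have hg := (hgood 0 (Nat.zero_le _)).2.2.1 (S t) hSt
  rw [toReal_apply_eq_pair _ measurableSet_Icc, pair_fmu _ hr, mul_zero, h.pair_eq _ le_rfl, hE,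
    hS0, Finset.range_zero, Finset.sum_empty, add_zero, one_div, inv_mul_le_iff₀ hr] at hg
  refine le_trans ?_ hg
  rw [nearInitial, Finset.natCast_card_filter]
  refine Finset.sum_le_sum fun j _ => ?_
  rw [sub_zero, if_pos (hvt (j + 1) (Nat.le_add_left 1 j))]
  split_ifs with hj
  · rw [Set.indicator_of_mem (show _ ∈ Set.Icc _ _ from ⟨by linarith, by linarith⟩), Pi.one_apply]
  · exact Set.indicator_nonneg (fun _ _ => zero_le_one) _

/-- Jobs with service time in `[kκ, (k+1)κ)` and residual service time in `(0, κ]` at the same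
time all arrived within a time window of fluid length less than `l`. -/
lemma card_nearArrived_class_le (hgood : GoodPath U v μ ν T L r ε l p κ γ M)
    (h : StateEqns U v Z0 vt μ S) (hU0 : U 0 = 0) (hU : Monotone U)
    (hU' : Tendsto U atTop atTop) (hU1 : 0 < U 1) (hL : 1 < L) (hr : 0 < r) (hε : 0 < ε)
    (hM : 1 < M) (hκ : 0 < κ) (hκl : κ < l / (2 * M)) {m k : ℕ} {t : ℝ} (hm : m ≤ ⌊r * T⌋₊)
    (ht : t ∈ Set.Icc 0 L) (hk : k ≤ ⌈64 * M ^ 2 / (κ * ε ^ 2)⌉₊ + 1) :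
    ({i ∈ nearArrived U v S κ (r * (m + t)) |
        (k : ℝ) * κ ≤ v (i + 1) ∧ v (i + 1) < ((k : ℝ) + 1) * κ}.card : ℝ) ≤
      r * (ε / 8 * (ν (Set.Ico (((k : ℝ) - 1 / 2) * κ) (((k : ℝ) + 3 / 2) * κ))).toReal) := by
  set s : ℝ := r * (m + t) with hs
  set G := {i ∈ nearArrived U v S κ s |
    (k : ℝ) * κ ≤ v (i + 1) ∧ v (i + 1) < ((k : ℝ) + 1) * κ} with hG
  have hs0 : 0 ≤ s := mul_nonneg hr.le (add_nonneg (Nat.cast_nonneg m) ht.1)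
  have hrM : 0 < r * M := by positivity
  rcases G.eq_empty_or_nonempty with hne | hne
  · rw [hne, Finset.card_empty, Nat.cast_zero]
    positivity
  have hmem : ∀ i ∈ G, U (i + 1) ≤ s ∧ 0 < v (i + 1) - S s + S (U (i + 1)) ∧
      v (i + 1) - S s + S (U (i + 1)) ≤ κ ∧ (k : ℝ) * κ ≤ v (i + 1) ∧
      v (i + 1) < ((k : ℝ) + 1) * κ := fun i hi => by
    rw [hG, Finset.mem_filter, nearArrived, Finset.mem_filter, Finset.mem_range,
      ← Nat.succ_le_iff, le_Ecount_iff hU hU' (hU0.le.trans hs0)] at hi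
    tauto
  obtain ⟨i₀, hi₀, hmin⟩ := G.exists_min_image id hne
  obtain ⟨hU₀, hp₀, hκ₀, hk₀, hk₀'⟩ := hmem i₀ hi₀
  have hUpos : 0 < U (i₀ + 1) := hU1.trans_le (hU (Nat.le_add_left 1 i₀))
  have hwin : 2 * κ * M < l := by
    rw [lt_div_iff₀ (by positivity)] at hκl
    linarith
  have hgap : ∀ i ∈ G, U (i + 1) ≤ U (i₀ + 1) + r * (2 * κ * M) := fun i hi => by
    obtain ⟨hUi, hpi, hκi, hki, hki'⟩ := hmem i hi
    have hle : U (i₀ + 1) ≤ U (i + 1) := hU (Nat.succ_le_succ (hmin i hi))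
    have hserv := h.sub_le_mul hU0 hU hU' hUpos.le hle hrM
      (fun u hu => h.mass_pos hU0 hU hU' hu.1 (hu.2.trans hUi) hp₀)
      (fun u hu => hgood.mass_le hL hr hm ht (hUpos.le.trans hu.1) (hu.2.trans hUi))
    have hlt : S (U (i + 1)) - S (U (i₀ + 1)) ≤ 2 * κ := by linarith
    have := mul_le_mul_of_nonneg_left hlt hrM.le
    linarith
  set u : ℝ := max 0 (U (i₀ + 1) / r - (l - 2 * κ * M)) with hu
  have hu0 : 0 ≤ u := le_max_left _ _
  have hult : r * u < U (i₀ + 1) := by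
    rw [← lt_div_iff₀' hr]
    exact max_lt (by positivity) (by linarith)
  have hule : U (i₀ + 1) + r * (2 * κ * M) ≤ r * (u + l) := by
    have h1 : U (i₀ + 1) / r + 2 * κ * M ≤ u + l := by
      linarith [le_max_right 0 (U (i₀ + 1) / r - (l - 2 * κ * M))]
    have h2 := mul_le_mul_of_nonneg_left h1 hr.le
    rwa [mul_add, mul_div_cancel₀ _ hr.ne'] at h2
  obtain ⟨m', hm', t', ht', he⟩ := exists_nat_add_mem_Icc hL hm ht hu0
    (le_of_mul_le_mul_left (hult.le.trans hU₀) hr)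
  have hg := (hgood m' hm').2.2.2.2 t' ht' k hk
  rw [← he, one_div, inv_mul_le_iff₀ hr, Finset.sum_boole] at hg
  refine le_trans (Nat.cast_le.2 ?_) hg
  refine Finset.card_le_card_of_injOn (· + 1) (fun i hi => ?_) (add_left_injective 1).injOn
  have hi' : i ∈ G := hi
  obtain ⟨hUi, -, -, hki, hki'⟩ := hmem i hi'
  rw [Finset.mem_coe, Finset.mem_filter, Finset.mem_Ioc]
  refine ⟨⟨?_, ?_⟩, hki, hki'⟩
  · rw [← not_le, le_Ecount_iff hU hU' (hU0.le.trans (mul_nonneg hr.le hu0)), not_le]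
    exact hult.trans_le (hU (Nat.succ_le_succ (hmin i hi')))
  · have : 0 ≤ r * (u + l) := by
      linarith [mul_pos hr (mul_pos (mul_pos two_pos hκ) (one_pos.trans hM))]
    rw [le_Ecount_iff hU hU' (hU0.le.trans this)]
    exact (hgap i hi').trans hule

/-- When some job with large service time is nearly finished, all initial jobs and all jobs with
large service times that are nearly finished had a large residual service time when the last of
the latter arrived, so there are few of them by Markov's inequality. -/
lemma card_mul_le_of_nearArrived (hgood : GoodPath U v μ ν T L r ε l p κ γ M)
    (h : StateEqns U v Z0 vt μ S) (hU0 : U 0 = 0) (hU : Monotone U)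
    (hU' : Tendsto U atTop atTop) (hL : 1 < L) (hr : 0 < r) {m : ℕ} {t R : ℝ}
    (hm : m ≤ ⌊r * T⌋₊) (ht : t ∈ Set.Icc 0 L) (hR : 0 < R)
    (hne : {i ∈ nearArrived U v S κ (r * (m + t)) | R + κ ≤ v (i + 1)}.Nonempty) :
    ((nearInitial Z0 vt S κ (r * (m + t))).card +
      {i ∈ nearArrived U v S κ (r * (m + t)) | R + κ ≤ v (i + 1)}.card : ℝ) * R ≤ r * M := by
  set s : ℝ := r * (m + t) with hs
  set G := {i ∈ nearArrived U v S κ s | R + κ ≤ v (i + 1)} with hG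
  have hs0 : 0 ≤ s := mul_nonneg hr.le (add_nonneg (Nat.cast_nonneg m) ht.1)
  have hmem : ∀ i ∈ G, U (i + 1) ≤ s ∧ 0 < v (i + 1) - S s + S (U (i + 1)) ∧
      v (i + 1) - S s + S (U (i + 1)) ≤ κ ∧ R + κ ≤ v (i + 1) := fun i hi => by
    rw [hG, Finset.mem_filter, nearArrived, Finset.mem_filter, Finset.mem_range,
      ← Nat.succ_le_iff, le_Ecount_iff hU hU' (hU0.le.trans hs0)] at hi
    tauto
  obtain ⟨i₁, hi₁, hmax⟩ := G.exists_max_image id hne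
  obtain ⟨hU₁, -, hκ₁, hR₁⟩ := hmem i₁ hi₁
  have hUnn : 0 ≤ U (i₁ + 1) := hU0 ▸ hU (Nat.zero_le _)
  have hSs : R ≤ S s - S (U (i₁ + 1)) := by linarith
  refine le_trans ?_ (hgood.pair_id_le hL hr hm ht hUnn hU₁)
  rw [h.pair_eq _ hUnn, add_mul]
  have hnn : ∀ x : ℝ, 0 ≤ if 0 < x then id x else 0 := fun x => by
    split_ifs with hx
    exacts [hx.le, le_rfl]
  have hbd : ∀ x : ℝ, R ≤ x → R ≤ if 0 < x then id x else 0 := fun x hx => by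
    rwa [if_pos (hR.trans_le hx)]
  gcongr
  · calc _ = ∑ _j ∈ nearInitial Z0 vt S κ s, R := by rw [Finset.sum_const, nsmul_eq_mul]
      _ ≤ ∑ j ∈ nearInitial Z0 vt S κ s, _ := Finset.sum_le_sum fun j hj => hbd _ (by
          have := (Finset.mem_filter.1 hj).2.1
          linarith)
      _ ≤ _ := Finset.sum_le_sum_of_subset_of_nonneg (Finset.filter_subset _ _)
          fun j _ _ => hnn _
  · calc _ = ∑ _i ∈ G, R := by rw [Finset.sum_const, nsmul_eq_mul]
      _ ≤ ∑ i ∈ G, _ := Finset.sum_le_sum fun i hi => hbd _ (by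
          linarith [(hmem i hi).2.1])
      _ ≤ _ := Finset.sum_le_sum_of_subset_of_nonneg (fun i hi => by
          rw [Finset.mem_range, ← Nat.succ_le_iff, le_Ecount_iff hU hU' (hU0.le.trans hUnn)]
          exact hU (Nat.succ_le_succ (hmax i hi))) fun j _ _ => hnn _

end GoodPaths

end PSQ

open PSQ MeasureTheory in
/-- Lemma 3.10: little mass near the origin on good paths. -/
theorem stmt_7 (α : ℝ) (hα : 0 < α) (ν : Measure ℝ) (hν : IsProbabilityMeasure ν)
    (hνsupp : ν (Set.Iio 0) = 0)
    (T L r : ℝ) (hT : 1 < T) (hL : 1 < L) (hr : 0 < r)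
    (ε l p κ γ M : ℝ) (hconsts : GoodConsts α ε l p κ γ M)
    (U v : ℕ → ℝ) (Z0 : ℕ) (vt : ℕ → ℝ) (hq : QueueHyps U v Z0 vt)
    (μ : ℝ → Measure ℝ) (S : ℝ → ℝ) (hstate : StateEqns U v Z0 vt μ S)
    (hgood : GoodPath U v μ ν T L r ε l p κ γ M) :
    ∀ m : ℕ, m ≤ ⌊r*T⌋₊ → ∀ t ∈ Set.Icc (0:ℝ) L,
      ((fmu μ r ((m:ℝ)+t)) (Set.Icc 0 κ)).toReal ≤ ε/2 := by
  obtain ⟨⟨hε, hε1⟩, hl, -, hκ, -, hM, -, hκl, -⟩ := hconsts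
  obtain ⟨hU0, hU, hU1, hU', -, hvt⟩ := hq
  intro m hm t ht
  set s : ℝ := r * (m + t) with hs
  have hs0 : 0 ≤ s := mul_nonneg hr.le (add_nonneg (Nat.cast_nonneg m) ht.1)
  set N := ⌈64 * M ^ 2 / (κ * ε ^ 2)⌉₊ + 1 with hN
  set R : ℝ := N * κ with hR
  have hRlb : 64 * M ^ 2 / ε ^ 2 ≤ R := by
    have h1 : 64 * M ^ 2 / (κ * ε ^ 2) ≤ N := (Nat.le_ceil _).trans (by simp [hN])
    calc 64 * M ^ 2 / ε ^ 2 = 64 * M ^ 2 / (κ * ε ^ 2) * κ := by field_simp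
      _ ≤ R := mul_le_mul_of_nonneg_right h1 hκ.le
  have hRpos : 0 < R := lt_of_lt_of_le (by positivity) hRlb
  rw [toReal_apply_eq_pair _ measurableSet_Icc, pair_fmu _ hr,
    ← toReal_apply_eq_pair _ measurableSet_Icc, one_div, inv_mul_le_iff₀ hr,
    hstate.toReal_Icc_eq hs0,
    ← Finset.card_filter_add_card_filter_not (s := nearArrived U v S κ s)
      (fun i => R + κ ≤ v (i + 1)), Nat.cast_add, ← add_assoc]
  have hbig : ((nearInitial Z0 vt S κ s).card +
      {i ∈ nearArrived U v S κ s | R + κ ≤ v (i + 1)}.card : ℝ) ≤ r * (ε / 4) := by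
    rcases Finset.eq_empty_or_nonempty {i ∈ nearArrived U v S κ s | R + κ ≤ v (i + 1)}
      with hne | hne
    · rw [hne, Finset.card_empty, Nat.cast_zero, add_zero]
      exact card_nearInitial_le hgood hstate hU0 hU hU' hU1 hvt hr hs0
    · have hc := card_mul_le_of_nearArrived hgood hstate hU0 hU hU' hL hr hm ht hRpos hne
      refine le_of_mul_le_mul_right (hc.trans ?_) hRpos
      have h1 : M ≤ ε / 4 * (64 * M ^ 2 / ε ^ 2) := by
        have h2 : ε / 4 * (64 * M ^ 2 / ε ^ 2) = 16 * M ^ 2 / ε := by field_simp; norm_num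
        rw [h2, le_div_iff₀ hε]
        nlinarith
      rw [mul_assoc]
      gcongr
      exact h1.trans (by gcongr)
  have hsmall : ({i ∈ nearArrived U v S κ s | ¬ R + κ ≤ v (i + 1)}.card : ℝ) ≤ r * (ε / 4) := by
    have hvpos : ∀ i ∈ nearArrived U v S κ s, 0 ≤ v (i + 1) := fun i hi => by
      obtain ⟨hi1, hi2, -⟩ := Finset.mem_filter.1 hi
      rw [Finset.mem_range, ← Nat.succ_le_iff, le_Ecount_iff hU hU' (hU0.le.trans hs0)] at hi1
      have hmono := hstate.monotoneOn hU0 hU hU'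
        (show U (i + 1) ∈ Set.Ici 0 from hU0 ▸ hU (Nat.zero_le _)) hs0 hi1
      linarith
    have hfib := Finset.card_eq_sum_card_fiberwise (f := fun i => ⌊v (i + 1) / κ⌋₊)
      (s := {i ∈ nearArrived U v S κ s | ¬ R + κ ≤ v (i + 1)}) (t := Finset.range (N + 1))
      fun i hi => by
        obtain ⟨hi1, hi2⟩ := Finset.mem_filter.1 (Finset.mem_coe.1 hi)
        rw [Finset.mem_coe, Finset.mem_range, Nat.floor_lt (div_nonneg (hvpos i hi1) hκ.le),
          div_lt_iff₀ hκ]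
        push_cast
        linarith
    have hmono : Monotone fun n : ℕ => ((n : ℝ) - 1 / 2) * κ := fun a b hab => by
      have : (a : ℝ) ≤ b := Nat.cast_le.2 hab
      dsimp only
      gcongr
    have hcover := sum_measure_Ico_add_two_le ν hmono (N + 1)
    rw [hfib, Nat.cast_sum]
    calc _ ≤ ∑ k ∈ Finset.range (N + 1), r * (ε / 8 *
          (ν (Set.Ico (((k : ℝ) - 1 / 2) * κ) (((k + 2 : ℕ) - 1 / 2 : ℝ) * κ))).toReal) := by
          refine Finset.sum_le_sum fun k hk => ?_
          have hk' : ((k + 2 : ℕ) - 1 / 2 : ℝ) = k + 3 / 2 := by push_cast; ring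
          rw [hk']
          refine le_trans (Nat.cast_le.2 (Finset.card_le_card fun i hi => ?_))
            (card_nearArrived_class_le hgood hstate hU0 hU hU' hU1 hL hr hε hM hκ hκl hm ht
              (Nat.lt_succ_iff.1 (Finset.mem_range.1 hk)))
          obtain ⟨hi1, hi2⟩ := Finset.mem_filter.1 hi
          have hi3 := (Finset.mem_filter.1 hi1).1
          rw [Nat.floor_eq_iff (div_nonneg (hvpos i hi3) hκ.le), le_div_iff₀ hκ,
            div_lt_iff₀ hκ] at hi2
          exact Finset.mem_filter.2 ⟨hi3, hi2⟩
      _ = r * (ε / 8) * ∑ k ∈ Finset.range (N + 1),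
          (ν (Set.Ico (((k : ℝ) - 1 / 2) * κ) (((k + 2 : ℕ) - 1 / 2 : ℝ) * κ))).toReal := by
          rw [Finset.mul_sum]
          simp only [mul_assoc]
      _ ≤ r * (ε / 8) * 2 := by gcongr
      _ = r * (ε / 4) := by ring
  linarith
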